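/- arXiv:1501.04697 — 2 statements merged into one kernel-verified Lean document; each statement's English description precedes it below -/
import Mathlib

section
/- Let R be a commutative ring and let A and B be square matrices over R (possibly of different sizes). Then A and B are shift equivalent over R (with some lag ℓ ≥ 1) if and only if the R[t]-modules G_A and G_B are isomorphic. -/
noncomputable section

/-- The maps of the direct system `Rⁿ → Rⁿ → ⋯` in which each map is `x ↦ A x`:
the map from level `i` to level `j` is `x ↦ A^(j-i) x`. -/
def limApp {R : Type*} [CommRing R] {n : ℕ} (A : Matrix (Fin n) (Fin n) R)
    (i j : ℕ) (_ : i ≤ j) : (Fin n → R) →ₗ[R] (Fin n → R) :=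
  Matrix.mulVecLin (A ^ (j - i))

instance limApp_directedSystem {R : Type*} [CommRing R] {n : ℕ}
    (A : Matrix (Fin n) (Fin n) R) :
    DirectedSystem (fun _ : ℕ => Fin n → R) (fun i j h => limApp A i j h) where
  map_self i x := by simp [limApp]
  map_map {k j i} hij hjk x := by
    have h : A ^ (k - j) * A ^ (j - i) = A ^ (k - i) := by
      rw [← pow_add]; congr 1; omega
    simp only [limApp]
    rw [← h, Matrix.mulVecLin_mul]
    rfl

/-- `G_A`: the direct limit of the system `Rⁿ → Rⁿ → ⋯`, `x ↦ A x`. -/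
abbrev GA {R : Type*} [CommRing R] {n : ℕ} (A : Matrix (Fin n) (Fin n) R) : Type _ :=
  Module.DirectLimit (fun _ : ℕ => Fin n → R) (limApp A)

/-- The action of `t` on `G_A`, given by `t • [x, k] = [x, k + 1]`. -/
def shiftMap {R : Type*} [CommRing R] {n : ℕ} (A : Matrix (Fin n) (Fin n) R) :
    GA A →ₗ[R] GA A :=
  Module.DirectLimit.lift R ℕ (fun _ : ℕ => Fin n → R) (limApp A)
    (fun i => Module.DirectLimit.of R ℕ (fun _ : ℕ => Fin n → R) (limApp A) (i + 1))
    (by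
      intro i j hij x
      have h : limApp A i j hij x = limApp A (i + 1) (j + 1) (by omega) x := by
        simp [limApp, Nat.succ_sub_succ]
      rw [h]
      exact Module.DirectLimit.of_f)

/-- Shift equivalence over `R` with lag `l`. -/
def IsSE {R : Type*} [CommRing R] {m n : ℕ}
    (A : Matrix (Fin m) (Fin m) R) (B : Matrix (Fin n) (Fin n) R) (l : ℕ) : Prop :=
  ∃ (U : Matrix (Fin m) (Fin n) R) (V : Matrix (Fin n) (Fin m) R),
    A ^ l = U * V ∧ B ^ l = V * U ∧ A * U = U * B ∧ B * V = V * A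

namespace SEProof

open Matrix

variable {R : Type*} [CommRing R] {m n p : ℕ}

/-- The class `[x, k]`. -/
def mk (A : Matrix (Fin n) (Fin n) R) (k : ℕ) : (Fin n → R) →ₗ[R] GA A :=
  Module.DirectLimit.of R ℕ (fun _ : ℕ => Fin n → R) (limApp A) k

lemma exists_mk (A : Matrix (Fin n) (Fin n) R) (z : GA A) : ∃ k x, mk A k x = z :=
  Module.DirectLimit.exists_of z

lemma shift_mk (A : Matrix (Fin n) (Fin n) R) (k : ℕ) (x : Fin n → R) :
    shiftMap A (mk A k x) = mk A (k + 1) x := by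
  unfold shiftMap mk
  rw [Module.DirectLimit.lift_of]

lemma shift_pow_mk (A : Matrix (Fin n) (Fin n) R) (k j : ℕ) (x : Fin n → R) :
    (shiftMap A ^ j) (mk A k x) = mk A (k + j) x := by
  induction j with
  | zero => simp
  | succ j ih => rw [pow_succ', Module.End.mul_apply, ih, shift_mk, add_assoc]

lemma mk_pow (A : Matrix (Fin n) (Fin n) R) (k j : ℕ) (x : Fin n → R) :
    mk A (k + j) (A ^ j *ᵥ x) = mk A k x := by
  have h := Module.DirectLimit.of_f (R := R) (ι := ℕ) (G := fun _ : ℕ => Fin n → R)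
    (f := limApp A) (i := k) (j := k + j) (hij := Nat.le_add_right k j) (x := x)
  simpa [limApp, mk] using h

lemma mk_one (A : Matrix (Fin n) (Fin n) R) (k : ℕ) (x : Fin n → R) :
    mk A (k + 1) (A *ᵥ x) = mk A k x := by
  simpa using mk_pow A k 1 x

lemma mk_eq (A : Matrix (Fin n) (Fin n) R) (k : ℕ) (x y : Fin n → R)
    (h : mk A k x = mk A k y) : ∃ j, A ^ j *ᵥ x = A ^ j *ᵥ y := by
  obtain ⟨j, hj, h⟩ := Module.DirectLimit.exists_eq_of_of_eq h
  exact ⟨j - k, by simpa [limApp] using h⟩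

lemma pow_mulVec_mono (A : Matrix (Fin n) (Fin n) R) {i j : ℕ} (hij : i ≤ j)
    {x y : Fin n → R} (h : A ^ i *ᵥ x = A ^ i *ᵥ y) : A ^ j *ᵥ x = A ^ j *ᵥ y := by
  obtain ⟨d, rfl⟩ := Nat.exists_eq_add_of_le' hij
  rw [pow_add, ← mulVec_mulVec, ← mulVec_mulVec, h]

lemma mk_mat_eq (A : Matrix (Fin n) (Fin n) R) (k : ℕ) (M N : Matrix (Fin n) (Fin p) R)
    (h : ∀ x, mk A k (M *ᵥ x) = mk A k (N *ᵥ x)) : ∃ j, A ^ j * M = A ^ j * N := by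
  choose j hj using fun i : Fin p => mk_eq A k _ _ (h (Pi.single i 1))
  refine ⟨Finset.univ.sup j, ?_⟩
  apply Matrix.ext_of_mulVec_single
  intro i
  rw [← mulVec_mulVec, ← mulVec_mulVec]
  exact pow_mulVec_mono A (Finset.le_sup (Finset.mem_univ i)) (hj i)

lemma exists_mat (A : Matrix (Fin n) (Fin n) R) (f : (Fin p → R) →ₗ[R] GA A) :
    ∃ (k : ℕ) (M : Matrix (Fin n) (Fin p) R), ∀ x, f x = mk A k (M *ᵥ x) := by
  choose k v hv using fun i : Fin p => exists_mk A (f (Pi.single i 1))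
  have hk : ∀ i, k i ≤ Finset.univ.sup k := fun i => Finset.le_sup (Finset.mem_univ i)
  generalize Finset.univ.sup k = K at hk
  refine ⟨K, Matrix.of fun a i => (A ^ (K - k i) *ᵥ v i) a, fun x => ?_⟩
  suffices H : f = (mk A K).comp
      (Matrix.mulVecLin (Matrix.of fun a i => (A ^ (K - k i) *ᵥ v i) a)) from
    LinearMap.congr_fun H x
  apply LinearMap.pi_ext'
  intro i
  apply LinearMap.ext_ring
  simp only [LinearMap.comp_apply, LinearMap.single_apply, mulVecLin_apply, mulVec_single_one]
  rw [← hv i, ← mk_pow A (k i) (K - k i) (v i), Nat.add_sub_cancel' (hk i)]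
  rfl

lemma pow_comm {A : Matrix (Fin m) (Fin m) R} {B : Matrix (Fin n) (Fin n) R}
    {V : Matrix (Fin n) (Fin m) R} (h : B * V = V * A) (j : ℕ) : B ^ j * V = V * A ^ j := by
  induction j with
  | zero => simp
  | succ j ih => rw [pow_succ, Matrix.mul_assoc, h, ← Matrix.mul_assoc, ih, Matrix.mul_assoc,
      ← pow_succ]

lemma exists_rep (A : Matrix (Fin m) (Fin m) R) (B : Matrix (Fin n) (Fin n) R)
    (f : GA A →ₗ[R] GA B) (hf : ∀ z, f (shiftMap A z) = shiftMap B (f z)) :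
    ∃ (k : ℕ) (V : Matrix (Fin n) (Fin m) R), B * V = V * A ∧
      ∀ j x, f (mk A j x) = mk B (k + j) (V *ᵥ x) := by
  obtain ⟨k, W, hW⟩ := exists_mat B (f.comp (mk A 0))
  have hW' : ∀ j x, f (mk A j x) = mk B (k + j) (W *ᵥ x) := by
    intro j
    induction j with
    | zero => exact hW
    | succ j ih => intro x; rw [← shift_mk, hf, ih, shift_mk, add_assoc]
  obtain ⟨j, hj⟩ := mk_mat_eq B (k + 1) (B * W) (W * A) (fun x => by
    rw [← mulVec_mulVec, mk_one, ← mulVec_mulVec, ← hW' 1, ← hW, LinearMap.comp_apply,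
      ← mk_one A 0])
  refine ⟨k + j, B ^ j * W, ?_, fun i x => ?_⟩
  · rw [Matrix.mul_assoc, ← hj, ← Matrix.mul_assoc, ← Matrix.mul_assoc, ← pow_succ, ← pow_succ']
  · rw [hW', ← mk_pow B (k + i) j, mulVec_mulVec, add_right_comm]

lemma half (A : Matrix (Fin m) (Fin m) R) (B : Matrix (Fin n) (Fin n) R)
    (f : GA A →ₗ[R] GA B) (g : GA B →ₗ[R] GA A) (hgf : ∀ z, g (f z) = z)
    (k k' : ℕ) (V : Matrix (Fin n) (Fin m) R) (U : Matrix (Fin m) (Fin n) R)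
    (hV : ∀ j x, f (mk A j x) = mk B (k + j) (V *ᵥ x))
    (hU : ∀ j x, g (mk B j x) = mk A (k' + j) (U *ᵥ x)) :
    ∃ q, ∀ r, q ≤ r → A ^ r * (U * V) = A ^ (r + (k + k')) := by
  obtain ⟨q, hq⟩ := mk_mat_eq A (k' + k) (U * V) (A ^ (k' + k)) (fun x => by
    have h1 := hgf (mk A 0 x)
    rw [hV, hU, mulVec_mulVec, add_zero] at h1
    have h2 := mk_pow A 0 (k' + k) x
    rw [zero_add] at h2
    rw [h1, h2])
  refine ⟨q, fun r hr => ?_⟩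
  obtain ⟨d, rfl⟩ := Nat.exists_eq_add_of_le' hr
  rw [pow_add, Matrix.mul_assoc, hq, ← pow_add, ← pow_add]
  congr 1
  omega

theorem se_of_equiv (A : Matrix (Fin m) (Fin m) R) (B : Matrix (Fin n) (Fin n) R)
    (f : GA A →ₗ[R] GA B) (g : GA B →ₗ[R] GA A)
    (hgf : ∀ z, g (f z) = z) (hfg : ∀ z, f (g z) = z)
    (hf : ∀ z, f (shiftMap A z) = shiftMap B (f z))
    (hg : ∀ z, g (shiftMap B z) = shiftMap A (g z)) :
    ∃ l : ℕ, 1 ≤ l ∧ IsSE A B l := by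
  obtain ⟨k, V, hBV, hV⟩ := exists_rep A B f hf
  obtain ⟨k', U, hAU, hU⟩ := exists_rep B A g hg
  obtain ⟨q, hq⟩ := half A B f g hgf k k' V U hV hU
  obtain ⟨q', hq'⟩ := half B A g f hfg k' k U V hU hV
  refine ⟨q + q' + 1 + (k + k'), by omega, A ^ (q + q' + 1) * U, V, ?_, ?_, ?_, ?_⟩
  · rw [Matrix.mul_assoc, hq _ (by omega)]
  · rw [← Matrix.mul_assoc, ← pow_comm hBV, Matrix.mul_assoc, hq' _ (by omega), add_comm k' k]
  · rw [Matrix.mul_assoc, ← hAU, ← Matrix.mul_assoc, ← Matrix.mul_assoc, ← pow_succ, ← pow_succ']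
  · exact hBV

/-- The map of direct limits induced by an intertwining matrix. -/
def ind (A : Matrix (Fin m) (Fin m) R) (B : Matrix (Fin n) (Fin n) R)
    (V : Matrix (Fin n) (Fin m) R) (h : B * V = V * A) : GA A →ₗ[R] GA B :=
  Module.DirectLimit.map (fun _ => Matrix.mulVecLin V) (by
    intro i j hij
    unfold limApp
    rw [← Matrix.mulVecLin_mul, ← Matrix.mulVecLin_mul, pow_comm h])

lemma ind_mk (A : Matrix (Fin m) (Fin m) R) (B : Matrix (Fin n) (Fin n) R)
    (V : Matrix (Fin n) (Fin m) R) (h : B * V = V * A) (k : ℕ) (x : Fin m → R) :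
    ind A B V h (mk A k x) = mk B k (V *ᵥ x) := by
  unfold ind mk
  rw [Module.DirectLimit.map_apply_of]
  rfl

theorem equiv_of_se (A : Matrix (Fin m) (Fin m) R) (B : Matrix (Fin n) (Fin n) R) (l : ℕ)
    (h : IsSE A B l) :
    ∃ e : GA A ≃ₗ[R] GA B, ∀ z, e (shiftMap A z) = shiftMap B (e z) := by
  obtain ⟨U, V, hA, hB, hAU, hBV⟩ := h
  refine ⟨LinearEquiv.ofLinearMap (ind A B V hBV) ((shiftMap A ^ l).comp (ind B A U hAU)) ?_ ?_, ?_⟩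
  · refine LinearMap.ext fun z => ?_
    obtain ⟨k, x, rfl⟩ := exists_mk B z
    simp only [LinearMap.comp_apply, LinearMap.id_apply]
    rw [ind_mk, shift_pow_mk, ind_mk, mulVec_mulVec, ← hB, mk_pow]
  · refine LinearMap.ext fun z => ?_
    obtain ⟨k, x, rfl⟩ := exists_mk A z
    simp only [LinearMap.comp_apply, LinearMap.id_apply]
    rw [ind_mk, ind_mk, shift_pow_mk, mulVec_mulVec, ← hA, mk_pow]
  · intro z
    obtain ⟨k, x, rfl⟩ := exists_mk A z
    change ind A B V hBV _ = shiftMap B (ind A B V hBV _)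
    rw [shift_mk, ind_mk, ind_mk, shift_mk]

end SEProof

/-- Square matrices `A` and `B` over a commutative ring `R` are shift equivalent
over `R` (with some lag `l ≥ 1`) if and only if the `R[t]`-modules `G_A` and `G_B`
are isomorphic (with `t` acting by the shift `t • [x, k] = [x, k + 1]`). -/
theorem se_iff_GA_linearEquiv_GB {R : Type*} [CommRing R] {m n : ℕ}
    (A : Matrix (Fin m) (Fin m) R) (B : Matrix (Fin n) (Fin n) R) :
    (∃ l : ℕ, 1 ≤ l ∧ IsSE A B l) ↔
      Nonempty (Module.AEval' (shiftMap A) ≃ₗ[Polynomial R] Module.AEval' (shiftMap B)) := by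
  constructor
  · rintro ⟨l, -, h⟩
    obtain ⟨e, he⟩ := SEProof.equiv_of_se A B l h
    refine ⟨LinearEquiv.ofAEval (shiftMap A) (e.trans (Module.AEval'.of (shiftMap B))) ?_⟩
    intro z
    rw [LinearEquiv.trans_apply, LinearEquiv.trans_apply, Module.AEval'.X_smul_of, ← he]
    rfl
  · rintro ⟨e⟩
    let e' : GA A ≃ₗ[R] GA B := (Module.AEval'.of (shiftMap A)).trans
      ((e.restrictScalars R).trans (Module.AEval'.of (shiftMap B)).symm)
    have he : ∀ z, e' (shiftMap A z) = shiftMap B (e' z) := by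
      intro z
      change (Module.AEval'.of (shiftMap B)).symm (e (Module.AEval'.of (shiftMap A) _)) =
        shiftMap B ((Module.AEval'.of (shiftMap B)).symm (e (Module.AEval'.of (shiftMap A) z)))
      rw [← Module.AEval'.X_smul_of, map_smul, Module.AEval'.of_symm_X_smul]
    refine SEProof.se_of_equiv A B e'.toLinearMap e'.symm.toLinearMap
      (fun z => e'.symm_apply_apply z) (fun z => e'.apply_symm_apply z) he ?_
    intro z
    apply e'.injective
    change e' (e'.symm _) = e' (shiftMap A (e'.symm z))
    rw [he, e'.apply_symm_apply, e'.apply_symm_apply]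

end
end

section
/- Let C be a primitive n×n real matrix and let M be an n×n real matrix such that 3|M(i,j)| ≤ C(i,j) for all i, j. Let ε be a real number with 1/3 < ε < 2/3. Then the 2n×2n block matrix G = [[(1−ε)C + εM, ε(C − M)], [(1−ε)(C − M), εC + (1−ε)M]] has all entries nonnegative and is primitive. -/
/-- A square real matrix is primitive if it is entrywise nonnegative and some
power of it is entrywise strictly positive. -/
def IsPrimitive {m : Type*} [Fintype m] [DecidableEq m] (A : Matrix m m ℝ) : Prop :=
  (∀ i j, 0 ≤ A i j) ∧ ∃ k : ℕ, 0 < k ∧ ∀ i j, 0 < (A ^ k) i j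

theorem block_pow_lower {n : ℕ} (C : Matrix (Fin n) (Fin n) ℝ)
    (G : Matrix (Fin n ⊕ Fin n) (Fin n ⊕ Fin n) ℝ) (p : Fin n ⊕ Fin n → Fin n)
    (hp : ∀ a, p (Sum.inl a) = a)
    (hC : ∀ i j, 0 ≤ C i j) (hG : ∀ i j, (1 / 9 : ℝ) * C (p i) (p j) ≤ G i j) (k : ℕ) :
    ∀ i j, (1 / 9 : ℝ) ^ (k + 1) * (C ^ (k + 1)) (p i) (p j) ≤ (G ^ (k + 1)) i j := by
  have hCk : ∀ m : ℕ, ∀ i j, 0 ≤ (C ^ (m + 1)) i j := by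
    intro m
    induction m with
    | zero => simpa using hC
    | succ m ih =>
      intro i j
      rw [pow_succ, Matrix.mul_apply]
      exact Finset.sum_nonneg fun l _ => mul_nonneg (ih i l) (hC l j)
  have hG0 : ∀ i j, 0 ≤ G i j := fun i j =>
    le_trans (mul_nonneg (by norm_num) (hC _ _)) (hG i j)
  induction k with
  | zero => simpa using hG
  | succ k ih =>
    intro i j
    have hGk : ∀ i j, 0 ≤ (G ^ (k + 1)) i j := fun i j =>
      le_trans (mul_nonneg (by positivity) (hCk k _ _)) (ih i j)
    rw [pow_succ C (k + 1), pow_succ G (k + 1), Matrix.mul_apply, Matrix.mul_apply,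
      Fintype.sum_sum_type, Finset.mul_sum]
    refine le_trans (Finset.sum_le_sum (fun l _ => ?_))
      (le_add_of_nonneg_right (Finset.sum_nonneg fun l _ => mul_nonneg (hGk _ _) (hG0 _ _)))
    have h1 := ih i (Sum.inl l)
    have h2 := hG (Sum.inl l) j
    rw [hp] at h1 h2
    have := mul_le_mul h1 h2 (mul_nonneg (by norm_num) (hC _ _)) (hGk _ _)
    refine le_trans (le_of_eq ?_) this
    ring

/-- Let `C` be primitive, let `M` satisfy `3|M i j| ≤ C i j` for all entries, and let
`1/3 < ε < 2/3`.  Then the block matrix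
`G = [[(1−ε)C + εM, ε(C − M)], [(1−ε)(C − M), εC + (1−ε)M]]`
is entrywise nonnegative and primitive. -/
theorem block_mix_primitive {n : ℕ} (C M : Matrix (Fin n) (Fin n) ℝ)
    (hC : IsPrimitive C) (hM : ∀ i j, 3 * |M i j| ≤ C i j)
    {ε : ℝ} (hε1 : 1 / 3 < ε) (hε2 : ε < 2 / 3) :
    (∀ i j, 0 ≤ (Matrix.fromBlocks ((1 - ε) • C + ε • M) (ε • (C - M))
        ((1 - ε) • (C - M)) (ε • C + (1 - ε) • M)) i j) ∧
      IsPrimitive (Matrix.fromBlocks ((1 - ε) • C + ε • M) (ε • (C - M))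
        ((1 - ε) • (C - M)) (ε • C + (1 - ε) • M)) := by
  have hG : ∀ i j, (1 / 9 : ℝ) * C (Sum.elim id id i) (Sum.elim id id j) ≤
      (Matrix.fromBlocks ((1 - ε) • C + ε • M) (ε • (C - M))
        ((1 - ε) • (C - M)) (ε • C + (1 - ε) • M)) i j := by
    rintro (i | i) (j | j) <;>
    · have h := hM i j
      have h0 := hC.1 i j
      have h1 : M i j ≤ C i j / 3 := by linarith [le_abs_self (M i j)]
      have h2 : -(C i j / 3) ≤ M i j := by linarith [neg_abs_le (M i j)]
      simp only [Matrix.fromBlocks_apply₁₁, Matrix.fromBlocks_apply₁₂,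
        Matrix.fromBlocks_apply₂₁, Matrix.fromBlocks_apply₂₂, Matrix.add_apply,
        Matrix.sub_apply, Matrix.smul_apply, smul_eq_mul, Sum.elim_inl, Sum.elim_inr, id]
      nlinarith [mul_nonneg (sub_nonneg.2 hε1.le) h0, mul_nonneg (sub_nonneg.2 hε2.le) h0,
        mul_nonneg (show 0 ≤ ε by linarith) (sub_nonneg.2 h1),
        mul_nonneg (show 0 ≤ ε by linarith) (sub_nonneg.2 h2),
        mul_nonneg (show 0 ≤ 1 - ε by linarith) (sub_nonneg.2 h1),
        mul_nonneg (show 0 ≤ 1 - ε by linarith) (sub_nonneg.2 h2)]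
  have hnn := fun i j => le_trans (mul_nonneg (by norm_num) (hC.1 _ _)) (hG i j)
  refine ⟨hnn, hnn, ?_⟩
  obtain ⟨k, hk, hpos⟩ := hC.2
  refine ⟨k, hk, fun i j => ?_⟩
  obtain ⟨k, rfl⟩ := Nat.exists_eq_succ_of_ne_zero hk.ne'
  exact lt_of_lt_of_le (mul_pos (by positivity) (hpos _ _))
    (block_pow_lower C _ (Sum.elim id id) (fun _ => rfl) hC.1 hG k i j)
end
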